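/- For every real p with 0 < p < 1/2, the mass problem D(p) is Muchnik equivalent to the mass problem IOE(h) for the function h(n) = 2^(2^n); that is, D(p) ≤_W IOE(2^(2^n)) and IOE(2^(2^n)) ≤_W D(p). -/

import Mathlib

open Filter

namespace Paper

/-! ### Oracle computability -/

/-- Codes for oracle Turing functionals (partial recursive operators with one
function oracle), following the pattern of `Nat.Partrec.Code`. -/
inductive OracleCode : Type
  | zero
  | succ
  | left
  | right
  | oracle
  | pair : OracleCode → OracleCode → OracleCode
  | comp : OracleCode → OracleCode → OracleCode
  | prec : OracleCode → OracleCode → OracleCode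
  | rfind' : OracleCode → OracleCode

/-- Evaluation of an oracle code with oracle `g : ℕ → ℕ`. -/
def OracleCode.eval (g : ℕ → ℕ) : OracleCode → ℕ →. ℕ
  | .zero => pure 0
  | .succ => Nat.succ
  | .left => ↑fun n : ℕ => n.unpair.1
  | .right => ↑fun n : ℕ => n.unpair.2
  | .oracle => ↑fun n : ℕ => g n
  | .pair cf cg => fun n => Nat.pair <$> eval g cf n <*> eval g cg n
  | .comp cf cg => fun n => eval g cg n >>= eval g cf
  | .prec cf cg =>
    Nat.unpaired fun a n =>
      n.rec (eval g cf a) fun y IH => do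
        let i ← IH
        eval g cg (Nat.pair a (Nat.pair y i))
  | .rfind' cf =>
    Nat.unpaired fun a m =>
      (Nat.rfind fun n => (fun m => m = 0) <$> eval g cf (Nat.pair a (n + m))).map (· + m)

/-- Turing reducibility: `f ≤_T g` iff some oracle functional with oracle `g`
computes `f` (totally). -/
def TuringLE (f g : ℕ → ℕ) : Prop :=
  ∃ c : OracleCode, ∀ n, OracleCode.eval g c n = Part.some (f n)

/-- Turing equivalence. -/
def TuringEquiv (f g : ℕ → ℕ) : Prop := TuringLE f g ∧ TuringLE g f

/-- A mass problem is a set of functions `ℕ → ℕ`. -/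
abbrev MassProblem := Set (ℕ → ℕ)

/-- Muchnik (weak) reducibility `B ≤_W C`. -/
def MuchnikLE (B C : MassProblem) : Prop := ∀ g ∈ C, ∃ f ∈ B, TuringLE f g

/-- Muchnik equivalence. -/
def MuchnikEquiv (B C : MassProblem) : Prop := MuchnikLE B C ∧ MuchnikLE C B

/-- Medvedev (strong) reducibility `B ≤_S C`: a single Turing functional is
defined on all of `C` and maps each member of `C` to a member of `B`. -/
def MedvedevLE (B C : MassProblem) : Prop :=
  ∃ c : OracleCode, ∀ g ∈ C, ∃ f ∈ B, ∀ n, OracleCode.eval g c n = Part.some (f n)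

/-- Medvedev equivalence. -/
def MedvedevEquiv (B C : MassProblem) : Prop := MedvedevLE B C ∧ MedvedevLE C B

/-! ### Density notions -/

/-- Lower (asymptotic) density of a set of naturals. -/
noncomputable def lowerDensity (z : Set ℕ) : ℝ :=
  Filter.liminf (fun n => (Nat.card ↥(z ∩ Set.Iio n) : ℝ) / n) Filter.atTop

/-- `x ↔ y`: the agreement set of two functions. -/
def agree (x y : ℕ → ℕ) : Set ℕ := {n | x n = y n}

/-- A bit sequence is a `{0,1}`-valued function. -/
def IsBitSeq (x : ℕ → ℕ) : Prop := ∀ n, x n < 2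

/-- The mass problem `D(p)`. -/
def probD (p : ℝ) : MassProblem :=
  {y | IsBitSeq y ∧ ∀ x : ℕ → ℕ, IsBitSeq x → Computable x →
    lowerDensity (agree x y) ≤ p}

/-- The mass problem `B(p)`. -/
def probB (p : ℝ) : MassProblem :=
  {y | IsBitSeq y ∧ ∀ x : ℕ → ℕ, IsBitSeq x → Computable x →
    p < lowerDensity (agree x y)}

/-- The mass problem `IOE(h)`. -/
def IOE (h : ℕ → ℕ) : MassProblem :=
  {f | ∀ x : ℕ → ℕ, Computable x → (∀ n, x n < h n) → ∃ᶠ n in atTop, f n = x n}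

/-- The mass problem `AED(h)`. -/
def AED (h : ℕ → ℕ) : MassProblem :=
  {f | (∀ n, f n < h n) ∧ ∀ x : ℕ → ℕ, Computable x → ∀ᶠ n in atTop, f n ≠ x n}

/-! ### Hamming distance and the problems `D⟨≠*,ĥ,q⟩`, `B⟨≠*,ĥ,q⟩` -/

/-- Normalized Hamming distance between `a` and `b`, viewed as binary strings
of length `r` (via binary expansion with leading zeros). -/
noncomputable def nhd (r a b : ℕ) : ℝ :=
  (((Finset.range r).filter fun i => a.testBit i ≠ b.testBit i).card : ℝ) / r

/-- The mass problem `D⟨≠*, ĥ, q⟩`. -/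
def probDneq (hh : ℕ → ℕ) (q : ℝ) : MassProblem :=
  {y | (∀ n, y n < 2 ^ hh n) ∧ ∀ x : ℕ → ℕ, Computable x → (∀ n, x n < 2 ^ hh n) →
    ∃ᶠ n in atTop, nhd (hh n) (x n) (y n) < q}

/-- The mass problem `B⟨≠*, ĥ, q⟩`. -/
def probBneq (hh : ℕ → ℕ) (q : ℝ) : MassProblem :=
  {y | (∀ n, y n < 2 ^ hh n) ∧ ∀ x : ℕ → ℕ, Computable x → (∀ n, x n < 2 ^ hh n) →
    ∀ᶠ n in atTop, q ≤ nhd (hh n) (x n) (y n)}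

/-! ### Slaloms, coded as functions `ℕ → ℕ` via binary digits -/

/-- `s : ℕ → ℕ`, coding finite sets via binary digits (`i ∈ s(n)` iff the
`i`-th bit of `s n` is set), is an `L`-slalom bounded by `u`. -/
def IsSlalomCode (u : ℕ → ℕ) (L : ℕ) (s : ℕ → ℕ) : Prop :=
  ∀ n, (∀ i, (s n).testBit i = true → i < u n) ∧
    ((Finset.range (u n)).filter fun i => (s n).testBit i = true).card ≤ L

/-- The mass problem `D⟨∌*, u, L⟩`. -/
def probDSlalom (u : ℕ → ℕ) (L : ℕ) : MassProblem :=
  {s | IsSlalomCode u L s ∧ ∀ y : ℕ → ℕ, Computable y → (∀ n, y n < u n) →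
    ∃ᶠ n in atTop, (s n).testBit (y n) = true}

/-- The mass problem `B⟨∌*, u, L⟩`. -/
def probBSlalom (u : ℕ → ℕ) (L : ℕ) : MassProblem :=
  {y | (∀ n, y n < u n) ∧ ∀ s : ℕ → ℕ, Computable s → IsSlalomCode u L s →
    ∀ᶠ n in atTop, (s n).testBit (y n) = false}

/-! ### Gamma and Delta values -/

/-- `γ(A)`. -/
noncomputable def gammaVal (A : ℕ → ℕ) : ℝ :=
  sSup ((fun x => lowerDensity (agree A x)) '' {x | IsBitSeq x ∧ Computable x})

/-- `Γ(A)`. -/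
noncomputable def GammaVal (A : ℕ → ℕ) : ℝ :=
  sInf (gammaVal '' {Y | IsBitSeq Y ∧ TuringEquiv Y A})

/-- `δ(A)`. -/
noncomputable def deltaVal (A : ℕ → ℕ) : ℝ :=
  sInf ((fun x => lowerDensity (agree A x)) '' {x | IsBitSeq x ∧ Computable x})

/-- `Δ(A)`. -/
noncomputable def DeltaVal (A : ℕ → ℕ) : ℝ :=
  sSup (deltaVal '' {Y | IsBitSeq Y ∧ TuringLE Y A})

/-! ### Cardinal characteristics -/

/-- The cardinal characteristic `𝔡(p)`. -/
noncomputable def dChar (p : ℝ) : Cardinal :=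
  sInf {c : Cardinal | ∃ G : Set (ℕ → ℕ), c = Cardinal.mk G ∧ (∀ y ∈ G, IsBitSeq y) ∧
    ∀ x : ℕ → ℕ, IsBitSeq x → ∃ y ∈ G, p < lowerDensity (agree x y)}

/-- The cardinal characteristic `𝔟(p)`. -/
noncomputable def bChar (p : ℝ) : Cardinal :=
  sInf {c : Cardinal | ∃ F : Set (ℕ → ℕ), c = Cardinal.mk F ∧ (∀ x ∈ F, IsBitSeq x) ∧
    ∀ y : ℕ → ℕ, IsBitSeq y → ∃ x ∈ F, lowerDensity (agree x y) ≤ p}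

/-- The cardinal characteristic `𝔡(≠*, h)`. -/
noncomputable def dNeq (h : ℕ → ℕ) : Cardinal :=
  sInf {c : Cardinal | ∃ G : Set (ℕ → ℕ), c = Cardinal.mk G ∧ (∀ y ∈ G, ∀ n, y n < h n) ∧
    ∀ x : ℕ → ℕ, ∃ y ∈ G, ∀ᶠ n in atTop, x n ≠ y n}

/-- The cardinal characteristic `𝔟(≠*, h)`. -/
noncomputable def bNeq (h : ℕ → ℕ) : Cardinal :=
  sInf {c : Cardinal | ∃ F : Set (ℕ → ℕ), c = Cardinal.mk F ∧
    ∀ y : ℕ → ℕ, (∀ n, y n < h n) → ∃ x ∈ F, ∃ᶠ n in atTop, x n = y n}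

/-- The cardinal characteristic `𝔡⟨≠*, ĥ, q⟩`. -/
noncomputable def dHam (hh : ℕ → ℕ) (q : ℝ) : Cardinal :=
  sInf {c : Cardinal | ∃ G : Set (ℕ → ℕ), c = Cardinal.mk G ∧
    (∀ y ∈ G, ∀ n, y n < 2 ^ hh n) ∧
    ∀ x : ℕ → ℕ, (∀ n, x n < 2 ^ hh n) →
      ∃ y ∈ G, ∀ᶠ n in atTop, q ≤ nhd (hh n) (x n) (y n)}

/-- The cardinal characteristic `𝔟⟨≠*, ĥ, q⟩`. -/
noncomputable def bHam (hh : ℕ → ℕ) (q : ℝ) : Cardinal :=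
  sInf {c : Cardinal | ∃ F : Set (ℕ → ℕ), c = Cardinal.mk F ∧
    (∀ x ∈ F, ∀ n, x n < 2 ^ hh n) ∧
    ∀ y : ℕ → ℕ, (∀ n, y n < 2 ^ hh n) →
      ∃ x ∈ F, ∃ᶠ n in atTop, nhd (hh n) (x n) (y n) < q}

/-- `s : ℕ → Finset ℕ` is an `L`-slalom bounded by `u`. -/
def IsSlalom (u : ℕ → ℕ) (L : ℕ) (s : ℕ → Finset ℕ) : Prop :=
  ∀ n, (∀ i ∈ s n, i < u n) ∧ (s n).card ≤ L

/-- The cardinal characteristic `𝔡⟨∌*, u, L⟩`. -/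
noncomputable def dSlalom (u : ℕ → ℕ) (L : ℕ) : Cardinal :=
  sInf {c : Cardinal | ∃ G : Set (ℕ → ℕ), c = Cardinal.mk G ∧ (∀ y ∈ G, ∀ n, y n < u n) ∧
    ∀ s : ℕ → Finset ℕ, IsSlalom u L s → ∃ y ∈ G, ∀ᶠ n in atTop, y n ∉ s n}

/-- The cardinal characteristic `𝔟⟨∌*, u, L⟩`. -/
noncomputable def bSlalom (u : ℕ → ℕ) (L : ℕ) : Cardinal :=
  sInf {c : Cardinal | ∃ F : Set (ℕ → Finset ℕ), c = Cardinal.mk F ∧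
    (∀ s ∈ F, IsSlalom u L s) ∧
    ∀ y : ℕ → ℕ, (∀ n, y n < u n) → ∃ s ∈ F, ∃ᶠ n in atTop, y n ∈ s n}

/-! ### Order functions and list decoding -/

/-- An order function: nondecreasing, unbounded and computable. -/
def IsOrderFunc (F : ℕ → ℕ) : Prop :=
  Computable F ∧ Monotone F ∧ ∀ b : ℕ, ∃ n, b < F n

/-- The list-decoding property for parameters `q`, `ε`, `L`: for every length `r`
there is a set `C` of `2^⌊εr⌋` binary strings of length `r` (coded as numbers
below `2^r`) such that every string has at most `L` elements of `C` within
normalized Hamming distance `< q`. -/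
def ListDecoding (q ε : ℝ) (L : ℕ) : Prop :=
  ∀ r : ℕ, ∃ C : Finset ℕ, (∀ a ∈ C, a < 2 ^ r) ∧ C.card = 2 ^ ⌊ε * r⌋₊ ∧
    ∀ σ < 2 ^ r, (C.filter fun τ => nhd r σ τ < q).card ≤ L


/-! ### Computability tools -/

/-- Translate ordinary codes to oracle codes. -/
def ofCode : Nat.Partrec.Code → OracleCode
  | .zero => .zero
  | .succ => .succ
  | .left => .left
  | .right => .right
  | .pair a b => .pair (ofCode a) (ofCode b)
  | .comp a b => .comp (ofCode a) (ofCode b)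
  | .prec a b => .prec (ofCode a) (ofCode b)
  | .rfind' a => .rfind' (ofCode a)

theorem eval_ofCode (g : ℕ → ℕ) (c : Nat.Partrec.Code) :
    OracleCode.eval g (ofCode c) = c.eval := by
  induction c with
  | zero => rfl
  | succ => rfl
  | left => rfl
  | right => rfl
  | pair a b ha hb => simp only [ofCode, OracleCode.eval, Nat.Partrec.Code.eval, ha, hb]; rfl
  | comp a b ha hb => simp only [ofCode, OracleCode.eval, Nat.Partrec.Code.eval, ha, hb]; rfl
  | prec a b ha hb => simp only [ofCode, OracleCode.eval, Nat.Partrec.Code.eval, ha, hb]; rfl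
  | rfind' a ha => simp only [ofCode, OracleCode.eval, Nat.Partrec.Code.eval, ha]; rfl

theorem exists_oracleCode {f : ℕ → ℕ} (hf : Computable f) :
    ∃ c : OracleCode, ∀ g n, OracleCode.eval g c n = Part.some (f n) := by
  have h : Nat.Partrec (f : ℕ →. ℕ) := Partrec.nat_iff.1 hf
  obtain ⟨c, hc⟩ := Nat.Partrec.Code.exists_code.1 h
  refine ⟨ofCode c, fun g n => ?_⟩
  rw [eval_ofCode, hc]; rfl

theorem eval_comp_some {g : ℕ → ℕ} {cf cg : OracleCode} {n a : ℕ}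
    (h : OracleCode.eval g cg n = Part.some a) :
    OracleCode.eval g (.comp cf cg) n = OracleCode.eval g cf a := by
  change (OracleCode.eval g cg n).bind (fun a => OracleCode.eval g cf a) = _
  rw [h, Part.bind_some]

theorem eval_prec_succ' (g : ℕ → ℕ) (cf cg : OracleCode) (a k : ℕ) :
    OracleCode.eval g (.prec cf cg) (Nat.pair a (Nat.succ k)) =
      (OracleCode.eval g (.prec cf cg) (Nat.pair a k)).bind fun i =>
        OracleCode.eval g cg (Nat.pair a (Nat.pair k i)) := by
  rw [OracleCode.eval, Nat.unpaired, Nat.unpair_pair]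
  simp

theorem eval_pair_some {g : ℕ → ℕ} {cf cg : OracleCode} {n a b : ℕ}
    (h : OracleCode.eval g cf n = Part.some a) (h' : OracleCode.eval g cg n = Part.some b) :
    OracleCode.eval g (.pair cf cg) n = Part.some (Nat.pair a b) := by
  simp [OracleCode.eval, h, h', Seq.seq]

theorem turingLE_comp {G g q : ℕ → ℕ} {H : ℕ → ℕ → ℕ} (hG : TuringLE G g)
    (hq : Computable q) (hH : Computable₂ H) :
    TuringLE (fun n => H n (G (q n))) g := by
  obtain ⟨c, hc⟩ := hG
  obtain ⟨cq, hcq⟩ := exists_oracleCode hq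
  obtain ⟨ci, hci⟩ := exists_oracleCode (f := fun n => n) Computable.id
  obtain ⟨cH, hcH⟩ := exists_oracleCode (f := fun n => H n.unpair.1 n.unpair.2)
    (hH.comp (Computable.fst.comp Computable.unpair) (Computable.snd.comp Computable.unpair))
  refine ⟨.comp cH (.pair ci (.comp c cq)), fun n => ?_⟩
  rw [eval_comp_some (eval_pair_some (hci g n) ((eval_comp_some (hcq g n)).trans (hc _))), hcH]
  simp

theorem turingLE_refl (g : ℕ → ℕ) : TuringLE g g := ⟨.oracle, fun _ => rfl⟩

/-- The number with binary digits `g 0, ..., g (n-1)`. -/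
def bitSum (g : ℕ → ℕ) (n : ℕ) : ℕ := ∑ j ∈ Finset.range n, g j * 2 ^ j

theorem computable_pow2 : Computable fun n : ℕ => 2 ^ n := by
  have : Primrec₂ ((· ^ ·) : ℕ → ℕ → ℕ) := Primrec₂.unpaired'.1 Nat.Primrec.pow
  exact (this.comp (Primrec.const 2) Primrec.id).to_comp

theorem computable_sum {α : Type*} [Primcodable α] {F : α → ℕ → ℕ} {N : α → ℕ}
    (hF : Computable₂ F) (hN : Computable N) :
    Computable fun a => ∑ j ∈ Finset.range (N a), F a j := by
  have h : Computable fun a => (Nat.rec 0 (fun y IH => IH + F a y) (N a) : ℕ) := by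
    refine Computable.nat_rec (h := fun a p => p.2 + F a p.1) hN (Computable.const 0) ?_
    refine Computable₂.mk ?_
    exact (Primrec.nat_add.to_comp).comp (Computable.snd.comp Computable.snd)
      (hF.comp Computable.fst (Computable.fst.comp Computable.snd))
  refine h.of_eq fun a => ?_
  induction N a with
  | zero => simp
  | succ k ih => rw [Finset.sum_range_succ, ← ih]

theorem computable_ite_lt {α σ : Type*} [Primcodable α] [Primcodable σ] {a b : α → ℕ}
    {f g : α → σ} (ha : Computable a) (hb : Computable b) (hf : Computable f)
    (hg : Computable g) : Computable fun x => if a x < b x then f x else g x := by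
  have h : Computable fun x => decide (a x < b x) :=
    (Primrec.nat_lt.decide.to_comp).comp ha hb
  exact (Computable.cond h hf hg).of_eq fun x => by by_cases h : a x < b x <;> simp [h]

theorem computable_ite_eq {α σ : Type*} [Primcodable α] [Primcodable σ] {a b : α → ℕ}
    {f g : α → σ} (ha : Computable a) (hb : Computable b) (hf : Computable f)
    (hg : Computable g) : Computable fun x => if a x = b x then f x else g x := by
  have h : Computable fun x => decide (a x = b x) :=
    ((Primrec.eq (α := ℕ)).decide.to_comp).comp ha hb
  exact (Computable.cond h hf hg).of_eq fun x => by by_cases h : a x = b x <;> simp [h]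

section
variable {α : Type*} [Primcodable α] {f g : α → ℕ}
theorem cadd (hf : Computable f) (hg : Computable g) : Computable fun x => f x + g x :=
  Primrec.nat_add.to_comp.comp hf hg
theorem csub (hf : Computable f) (hg : Computable g) : Computable fun x => f x - g x :=
  Primrec.nat_sub.to_comp.comp hf hg
theorem cmul (hf : Computable f) (hg : Computable g) : Computable fun x => f x * g x :=
  Primrec.nat_mul.to_comp.comp hf hg
theorem cdiv (hf : Computable f) (hg : Computable g) : Computable fun x => f x / g x :=
  Primrec.nat_div.to_comp.comp hf hg
theorem cmod (hf : Computable f) (hg : Computable g) : Computable fun x => f x % g x :=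
  Primrec.nat_mod.to_comp.comp hf hg
theorem cpow2 (hf : Computable f) : Computable fun x => 2 ^ f x :=
  computable_pow2.comp hf
end

theorem clog2 : Computable fun n : ℕ => Nat.log 2 n := by
  have h : Primrec fun n : ℕ => Nat.findGreatest (fun k => 2 ^ k ≤ n) n := by
    have hp : Primrec₂ ((· ^ ·) : ℕ → ℕ → ℕ) := Primrec₂.unpaired'.1 Nat.Primrec.pow
    refine Primrec.nat_findGreatest (p := fun n k => 2 ^ k ≤ n) Primrec.id ?_
    exact Primrec.nat_le.comp (hp.comp (Primrec.const 2) Primrec.snd) Primrec.fst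
  refine h.to_comp.of_eq fun n => ?_
  rcases Nat.eq_zero_or_pos n with rfl | hn
  · simp
  · refine le_antisymm ?_ ?_
    · have := Nat.findGreatest_spec (P := fun k => 2 ^ k ≤ n) (n := n) (Nat.zero_le _) (by simp; omega)
      exact Nat.le_log_of_pow_le (by norm_num) this
    · exact Nat.le_findGreatest (Nat.log_le_self 2 n) (Nat.pow_log_le_self 2 hn.ne')

theorem computable_find {P : ℕ → ℕ → ℕ} (hP : Computable₂ P) (h : ∀ n, ∃ c, P n c = 0) :
    Computable fun n => Nat.find (h n) := by
  have hd : Computable₂ fun n c => decide (P n c = 0) :=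
    ((Primrec.eq (α := ℕ)).decide.to_comp).comp₂ hP (Computable.const 0).to₂
  have : Partrec fun n => Nat.rfind fun c => Part.some (decide (P n c = 0)) :=
    Partrec.rfind hd.partrec₂
  refine this.of_eq_tot fun n => ?_
  refine Nat.mem_rfind.2 ⟨?_, fun {m} hm => ?_⟩
  · simpa using Nat.find_spec (h n)
  · simpa using Nat.find_min (h n) hm

theorem turingLE_bitSum (g : ℕ → ℕ) : TuringLE (bitSum g) g := by
  obtain ⟨ci, hci⟩ := exists_oracleCode (f := fun n => n) Computable.id
  obtain ⟨cj, hcj⟩ := exists_oracleCode (f := fun n => n.unpair.2.unpair.1)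
    (Computable.fst.comp (Computable.unpair.comp (Computable.snd.comp Computable.unpair)))
  obtain ⟨cH, hcH⟩ := exists_oracleCode
    (f := fun n => n.unpair.1.unpair.2.unpair.2 + n.unpair.2 * 2 ^ n.unpair.1.unpair.2.unpair.1) (by
      have u1 : Computable fun n : ℕ => n.unpair.1 := Computable.fst.comp Computable.unpair
      have u2 : Computable fun n : ℕ => n.unpair.2 := Computable.snd.comp Computable.unpair
      exact cadd (u2.comp (u2.comp u1)) (cmul u2 (cpow2 (u1.comp (u2.comp u1)))))
  have key : ∀ n, OracleCode.eval g (.prec .zero (.comp cH (.pair ci (.comp .oracle cj))))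
      (Nat.pair 0 n) = Part.some (bitSum g n) := by
    intro n
    induction n with
    | zero =>
      simp only [OracleCode.eval, Nat.unpaired, Nat.unpair_pair]
      simp [bitSum]; rfl
    | succ k ih =>
      have e : OracleCode.eval g (.prec .zero (.comp cH (.pair ci (.comp .oracle cj))))
          (Nat.pair 0 (k + 1)) =
          (OracleCode.eval g (.prec .zero (.comp cH (.pair ci (.comp .oracle cj))))
            (Nat.pair 0 k)).bind fun i => OracleCode.eval g
              (.comp cH (.pair ci (.comp .oracle cj))) (Nat.pair 0 (Nat.pair k i)) := by
        exact eval_prec_succ' g _ _ 0 k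
      have ho : ∀ a, OracleCode.eval g .oracle a = Part.some (g a) := fun _ => rfl
      rw [e, ih, Part.bind_some,
        eval_comp_some (eval_pair_some (hci g _) ((eval_comp_some (hcj g _)).trans (ho _))), hcH]
      simp [bitSum, Finset.sum_range_succ]
  obtain ⟨cp, hcp⟩ := exists_oracleCode (f := fun n => Nat.pair 0 n)
    (Primrec₂.natPair.to_comp.comp (Computable.const 0) Computable.id)
  refine ⟨.comp (.prec .zero (.comp cH (.pair ci (.comp .oracle cj)))) cp, fun n => ?_⟩
  rw [eval_comp_some (hcp g n), key]

/-- Finitely many computable functions can be combined. -/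
theorem computable_family (m : ℕ) (x : ℕ → ℕ → ℕ) (hx : ∀ i < m, Computable (x i)) :
    ∃ X : ℕ → ℕ → ℕ, Computable₂ X ∧ ∀ i < m, ∀ n, X i n = x i n := by
  induction m with
  | zero => exact ⟨fun _ _ => 0, Computable.const 0, by simp⟩
  | succ m ih =>
    obtain ⟨X, hX, hXx⟩ := ih fun i hi => hx i (by omega)
    refine ⟨fun i n => if i = m then x m n else X i n, ?_, ?_⟩
    · exact computable_ite_eq Computable.fst (Computable.const m)
        ((hx m (by omega)).comp Computable.snd) hX
    · intro i hi n
      by_cases h : i = m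
      · simp [h]
      · simp only [h, if_false]; exact hXx i (by omega) n

theorem bitSum_lt {g : ℕ → ℕ} (hg : IsBitSeq g) (n : ℕ) : bitSum g n < 2 ^ n := by
  induction n with
  | zero => simp [bitSum]
  | succ k ih =>
    have : bitSum g (k+1) = bitSum g k + g k * 2 ^ k := Finset.sum_range_succ _ _
    have h1 := hg k
    have : g k * 2^k ≤ 1 * 2^k := Nat.mul_le_mul_right _ (by omega)
    rw [pow_succ]; omega

theorem bitSum_bit {g : ℕ → ℕ} (hg : IsBitSeq g) {n j : ℕ} (hj : j < n) :
    bitSum g n / 2 ^ j % 2 = g j := by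
  induction n with
  | zero => omega
  | succ k ih =>
    have e : bitSum g (k+1) = bitSum g k + g k * 2 ^ k := Finset.sum_range_succ _ _
    rcases Nat.lt_succ_iff_lt_or_eq.1 hj with h | rfl
    · rw [← ih h, e]
      obtain ⟨d, rfl⟩ : ∃ d, k = j + 1 + d := ⟨k - (j+1), by omega⟩
      have : g (j+1+d) * 2 ^ (j+1+d) = 2 ^ j * (2 * (2 ^ d * g (j+1+d))) := by ring
      rw [this, Nat.add_mul_div_left _ _ (by positivity)]; omega
    · rw [e, Nat.add_mul_div_right _ _ (by positivity), Nat.div_eq_of_lt (bitSum_lt hg j)]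
      have := hg j; omega

/-! ### Densities -/

/-- Number of agreements below `n`. -/
def cnt (x y : ℕ → ℕ) (n : ℕ) : ℕ := ((Finset.range n).filter fun j => x j = y j).card

theorem card_agree (x y : ℕ → ℕ) (n : ℕ) :
    Nat.card ↥(agree x y ∩ Set.Iio n) = cnt x y n := by
  rw [cnt, ← Nat.card_eq_finsetCard]
  congr 2
  ext j
  simp [agree, and_comm]

theorem cnt_le (x y : ℕ → ℕ) (n : ℕ) : cnt x y n ≤ n :=
  (Finset.card_filter_le _ _).trans (by simp)

theorem lowerDensity_eq (x y : ℕ → ℕ) :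
    lowerDensity (agree x y) = liminf (fun n => (cnt x y n : ℝ) / n) atTop := by
  simp only [lowerDensity, card_agree]

theorem ratio_bounds (x y : ℕ → ℕ) (n : ℕ) :
    0 ≤ (cnt x y n : ℝ) / n ∧ (cnt x y n : ℝ) / n ≤ 1 := by
  refine ⟨by positivity, div_le_one_of_le₀ (by exact_mod_cast cnt_le x y n) (by positivity)⟩

theorem lowerDensity_le {x y : ℕ → ℕ} {p : ℝ}
    (h : ∃ᶠ n in atTop, (cnt x y n : ℝ) / n ≤ p) : lowerDensity (agree x y) ≤ p := by
  rw [lowerDensity_eq]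
  refine Filter.liminf_le_of_frequently_le h ?_
  exact ⟨0, Filter.eventually_map.2 (Filter.Eventually.of_forall fun n => (ratio_bounds x y n).1)⟩

theorem le_lowerDensity {x y : ℕ → ℕ} {p : ℝ}
    (h : ∀ᶠ n in atTop, p ≤ (cnt x y n : ℝ) / n) : p ≤ lowerDensity (agree x y) := by
  rw [lowerDensity_eq]
  refine Filter.le_liminf_of_le ?_ h
  refine Filter.IsBoundedUnder.isCoboundedUnder_ge ?_
  exact ⟨1, Filter.eventually_map.2 (Filter.Eventually.of_forall fun n => (ratio_bounds x y n).2)⟩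

/-! ### The reduction of `D(p)` to `IOE(2^(2^n))` -/

/-- The query position. -/
def qpos (m i j : ℕ) : ℕ := (Nat.log 2 j + 1 + m - 1 - i) / m * m + i

theorem qpos_eq {m q j : ℕ} (hm : 0 < m) (hq : m ≤ q) (h1 : 2 ^ (q - m) ≤ j) (h2 : j < 2 ^ q) :
    qpos m (q % m) j = q := by
  have hj : j ≠ 0 := by
    have : 0 < 2 ^ (q - m) := by positivity
    omega
  have l1 : q - m ≤ Nat.log 2 j := Nat.le_log_of_pow_le (by norm_num) h1
  have l2 : Nat.log 2 j < q := Nat.log_lt_of_lt_pow hj h2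
  have hmod := Nat.mod_lt q hm
  have hdm := Nat.div_add_mod q m
  have : (Nat.log 2 j + 1 + m - 1 - q % m) / m = q / m := by
    apply Nat.div_eq_of_lt_le
    · have : q / m * m = m * (q / m) := Nat.mul_comm _ _
      omega
    · have : (q / m + 1) * m = m * (q / m) + m := by rw [Nat.succ_mul, Nat.mul_comm]
      omega
  rw [qpos, this, Nat.mul_comm]; omega

theorem computable_qpos (m i : ℕ) : Computable (qpos m i) := by
  have c : ∀ k : ℕ, Computable fun _ : ℕ => k := fun k => Computable.const k
  exact cadd (cmul (cdiv (csub (csub (cadd (cadd clog2 (c 1)) (c m)) (c 1)) (c i)) (c m)) (c m)) (c i)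

theorem probD_le_IOE {p : ℝ} (hp0 : 0 < p) :
    MuchnikLE (probD p) (IOE fun n => 2 ^ 2 ^ n) := by
  intro f hf
  obtain ⟨m0, hm0⟩ := exists_pow_lt_of_lt_one hp0 (show (1 / 2 : ℝ) < 1 by norm_num)
  set m := m0 + 1 with hm
  have hmp : (1 / 2 : ℝ) ^ m ≤ p := by
    refine le_trans ?_ hm0.le
    exact pow_le_pow_of_le_one (by norm_num) (by norm_num) (by omega)
  set y : ℕ → ℕ → ℕ := fun i j => 1 - f (qpos m i j) / 2 ^ j % 2 with hy
  have hyb : ∀ i, IsBitSeq (y i) := fun i j => by simp only [hy]; omega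
  by_contra hcon
  push Not at hcon
  have hT : ∀ i, TuringLE (y i) f := by
    intro i
    refine turingLE_comp (H := fun j v => 1 - v / 2 ^ j % 2) (turingLE_refl f)
      (computable_qpos m i) ?_
    exact csub (Computable.const 1) (cmod (cdiv Computable.snd (cpow2 Computable.fst))
      (Computable.const 2))
  have hn : ∀ i, ∃ x : ℕ → ℕ, IsBitSeq x ∧ Computable x ∧ p < lowerDensity (agree x (y i)) := by
    intro i
    have : y i ∉ probD p := fun h => hcon _ h (hT i)
    simp only [probD, Set.mem_ofPred_eq, not_and, not_forall, not_le] at this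
    obtain ⟨x, h1, h2, h3⟩ := this (hyb i)
    exact ⟨x, h1, h2, h3⟩
  choose x hxb hxc hxd using hn
  obtain ⟨X, hX, hXx⟩ := computable_family m x fun i _ => hxc i
  have hlt : ∀ q, q % m < m := fun q => Nat.mod_lt q (by omega)
  have hXx' : ∀ q, X (q % m) = x (q % m) := fun q => funext fun n => hXx _ (hlt q) n
  have hfreq := hf (fun q => bitSum (X (q % m)) (2 ^ q)) (by
    refine computable_sum (F := fun q j => X (q % m) j * 2 ^ j) ?_ computable_pow2
    exact cmul (hX.comp (cmod Computable.fst (Computable.const m)) Computable.snd)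
      (cpow2 Computable.snd)) (fun q => by
        rw [hXx']
        exact bitSum_lt (hxb _) _)
  have hev : ∀ i, ∀ᶠ n in atTop, p < (cnt (x i) (y i) n : ℝ) / n := by
    intro i
    by_contra h
    have h' : ∃ᶠ n in atTop, (cnt (x i) (y i) n : ℝ) / n ≤ p := by
      refine fun h2 => h ?_
      filter_upwards [h2] with n hn
      exact not_le.1 hn
    exact absurd (lowerDensity_le h') (not_le.2 (hxd i))
  have hev2 : ∀ᶠ n in atTop, ∀ i ∈ Finset.range m, p < (cnt (x i) (y i) n : ℝ) / n :=
    (Filter.eventually_all_finset _).2 fun i _ => hev i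
  have ht : Tendsto (fun q : ℕ => 2 ^ q) atTop atTop :=
    tendsto_pow_atTop_atTop_of_one_lt (by norm_num)
  obtain ⟨q, hfq, hq1, hqm⟩ :=
    (hfreq.and_eventually ((ht.eventually hev2).and (eventually_ge_atTop m))).exists
  have hlow := hq1 (q % m) (Finset.mem_range.2 (hlt q))
  have hc : cnt (x (q % m)) (y (q % m)) (2 ^ q) ≤ 2 ^ (q - m) := by
    rw [cnt]
    refine (Finset.card_le_card (t := Finset.range (2 ^ (q - m))) ?_).trans (by simp)
    intro j hj
    simp only [Finset.mem_filter, Finset.mem_range] at hj ⊢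
    by_contra hge
    have e := qpos_eq (m := m) (by omega) hqm (not_lt.1 hge) hj.1
    have hb := bitSum_bit (hxb (q % m)) hj.1
    simp only [hXx'] at hfq
    have h2 := hj.2
    simp only [hy, e] at h2
    rw [hfq, hb] at h2
    have := hxb (q % m) j
    omega
  have : (cnt (x (q % m)) (y (q % m)) (2 ^ q) : ℝ) / ((2 ^ q : ℕ) : ℝ) ≤ (1 / 2) ^ m := by
    rw [div_le_iff₀ (by positivity)]
    have h3 : ((2 : ℝ)) ^ q = 2 ^ (q - m) * 2 ^ m := by
      rw [← pow_add]; congr 1; omega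
    have h4 : (cnt (x (q % m)) (y (q % m)) (2 ^ q) : ℝ) ≤ 2 ^ (q - m) := by exact_mod_cast hc
    push_cast
    rw [h3, one_div, inv_pow]
    have : ((2:ℝ) ^ m)⁻¹ * (2 ^ (q - m) * 2 ^ m) = 2 ^ (q - m) := by field_simp
    rw [this]; exact h4
  linarith

/-! ### Binary codes with small pairwise agreement -/

/-- Number of positions below `r` at which the binary digits of `a` and `b` agree. -/
def ag (r a b : ℕ) : ℕ := ∑ j ∈ Finset.range r, if a / 2 ^ j % 2 = b / 2 ^ j % 2 then 1 else 0

theorem ag_comm (r a b : ℕ) : ag r a b = ag r b a := by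
  simp only [ag, eq_comm]

theorem ag_self (r a : ℕ) : ag r a a = r := by simp [ag]

/-- Digits as signs. -/
noncomputable def sg (a j : ℕ) : ℝ := if a / 2 ^ j % 2 = 1 then 1 else -1

theorem sg_mul (a b j : ℕ) :
    sg a j * sg b j = 2 * ((if a / 2 ^ j % 2 = b / 2 ^ j % 2 then 1 else 0 : ℕ) : ℝ) - 1 := by
  unfold sg
  rcases Nat.mod_two_eq_zero_or_one (a / 2 ^ j) with h | h <;>
  rcases Nat.mod_two_eq_zero_or_one (b / 2 ^ j) with h' | h' <;> simp [h, h'] <;> norm_num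

theorem sum_sg (r a b : ℕ) :
    ∑ j ∈ Finset.range r, sg a j * sg b j = 2 * (ag r a b : ℝ) - r := by
  simp only [sg_mul, Finset.sum_sub_distrib, ← Finset.mul_sum, ag]
  push_cast
  simp

theorem sg_sq (a j : ℕ) : sg a j ^ 2 = 1 := by
  unfold sg; split_ifs <;> norm_num

/-- Johnson bound. -/
theorem johnson {K r : ℕ} (hK : 0 < K) (hr : 0 < r) (S : Finset ℕ) (E : ℕ → ℕ) (Y : ℕ)
    (h1 : ∀ m ∈ S, 2 * K * ag r (E m) Y + 2 * r < K * r)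
    (h2 : ∀ m ∈ S, ∀ m' ∈ S, m ≠ m' → 2 * K ^ 2 * ag r (E m) (E m') ≤ (K ^ 2 + 2) * r) :
    S.card ≤ K ^ 2 := by
  have hK' : (0 : ℝ) < K := by exact_mod_cast hK
  have hr' : (0 : ℝ) < r := by exact_mod_cast hr
  set s : ℝ := (S.card : ℝ) with hs
  have hs0 : 0 ≤ s := by positivity
  have a1 : ∀ m ∈ S, K * (2 * (ag r (E m) Y : ℝ) - r) ≤ -2 * r := by
    intro m hm
    have : (2 * K * ag r (E m) Y + 2 * r : ℝ) < K * r := by exact_mod_cast h1 m hm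
    nlinarith
  have a2 : ∀ m ∈ S, ∀ m' ∈ S, m ≠ m' → K ^ 2 * (2 * (ag r (E m) (E m') : ℝ) - r) ≤ 2 * r := by
    intro m hm m' hm' hne
    have : (2 * K ^ 2 * ag r (E m) (E m') : ℝ) ≤ (K ^ 2 + 2) * r := by
      exact_mod_cast h2 m hm m' hm' hne
    nlinarith
  set V : ℕ → ℝ := fun j => ∑ m ∈ S, sg (E m) j with hV
  have cs := Finset.sum_mul_sq_le_sq_mul_sq (Finset.range r) (sg Y) V
  simp only [sg_sq, Finset.sum_const, Finset.card_range, nsmul_eq_mul, mul_one] at cs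
  have b1 : ∑ j ∈ Finset.range r, sg Y j * V j = ∑ m ∈ S, (2 * (ag r (E m) Y : ℝ) - r) := by
    simp only [hV, Finset.mul_sum]
    rw [Finset.sum_comm]
    refine Finset.sum_congr rfl fun m _ => ?_
    rw [sum_sg, ag_comm]
  have b2 : ∑ j ∈ Finset.range r, V j ^ 2 =
      ∑ m ∈ S, ∑ m' ∈ S, (2 * (ag r (E m) (E m') : ℝ) - r) := by
    simp only [hV, sq, Finset.sum_mul_sum]
    rw [Finset.sum_comm]
    refine Finset.sum_congr rfl fun m _ => ?_
    rw [Finset.sum_comm]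
    exact Finset.sum_congr rfl fun m' _ => sum_sg _ _ _
  have c1 : K * (∑ m ∈ S, (2 * (ag r (E m) Y : ℝ) - r)) ≤ - (2 * r * s) := by
    rw [Finset.mul_sum]
    refine (Finset.sum_le_sum a1).trans ?_
    simp only [Finset.sum_const, nsmul_eq_mul, ← hs]
    linarith
  have c2 : K ^ 2 * (∑ m ∈ S, ∑ m' ∈ S, (2 * (ag r (E m) (E m') : ℝ) - r)) ≤
      s * (K ^ 2 * r + s * (2 * r)) := by
    rw [Finset.mul_sum]
    have : ∀ m ∈ S, (K : ℝ) ^ 2 * (∑ m' ∈ S, (2 * (ag r (E m) (E m') : ℝ) - r)) ≤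
        K ^ 2 * r + s * (2 * r) := by
      intro m hm
      rw [Finset.mul_sum]
      have : ∀ m' ∈ S, (K : ℝ) ^ 2 * (2 * (ag r (E m) (E m') : ℝ) - r) ≤
          (if m = m' then (K : ℝ) ^ 2 * r else 0) + 2 * r := by
        intro m' hm'
        by_cases h : m = m'
        · subst h
          simp only [ag_self, if_true]
          nlinarith
        · simp only [h, if_false]
          linarith [a2 m hm m' hm' h]
      refine (Finset.sum_le_sum this).trans ?_
      rw [Finset.sum_add_distrib, Finset.sum_ite_eq, if_pos hm]
      simp [← hs]
    refine (Finset.sum_le_sum this).trans ?_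
    simp only [Finset.sum_const, nsmul_eq_mul, ← hs]
    linarith
  rw [b1, b2] at cs
  set A := ∑ m ∈ S, (2 * (ag r (E m) Y : ℝ) - r)
  set B := ∑ m ∈ S, ∑ m' ∈ S, (2 * (ag r (E m) (E m') : ℝ) - r)
  have d1 : (2 * r * s) ^ 2 ≤ (K * A) ^ 2 := by
    have : 0 ≤ 2 * r * s := by positivity
    nlinarith
  have d2 : (K * A) ^ 2 ≤ r * (s * (K ^ 2 * r + s * (2 * r))) := by
    calc (K * A) ^ 2 = K ^ 2 * A ^ 2 := by ring
      _ ≤ K ^ 2 * (r * B) := by gcongr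
      _ = r * (K ^ 2 * B) := by ring
      _ ≤ _ := by gcongr
  have d3 : (2 * r ^ 2) * s ^ 2 ≤ r ^ 2 * (s * K ^ 2) := by nlinarith
  have d4 : s ≤ K ^ 2 := by
    by_contra h
    push Not at h
    have hKs : 0 < (K : ℝ) ^ 2 := by positivity
    have : 0 < s := by linarith
    have r2 : 0 < (r : ℝ) ^ 2 := by positivity
    have : s * K ^ 2 < s * s := by gcongr
    have : r ^ 2 * (s * K ^ 2) < r ^ 2 * (s * s) := by gcongr
    nlinarith [mul_pos r2 (mul_pos ‹0 < s› ‹0 < s›)]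
  rw [hs] at d4
  exact_mod_cast d4

theorem bit_low {w r j : ℕ} (hj : j < r) : (2 ^ r + w) / 2 ^ j % 2 = w / 2 ^ j % 2 := by
  obtain ⟨d, rfl⟩ : ∃ d, r = j + 1 + d := ⟨r - (j+1), by omega⟩
  have : 2 ^ (j + 1 + d) + w = w + 2 ^ j * (2 * 2 ^ d) := by ring
  rw [this, Nat.add_mul_div_left _ _ (by positivity)]; omega

theorem ag_succ_low {w r : ℕ} (a : ℕ) (hw : w < 2 ^ r) :
    ag (r + 1) w a = ag r w a + if a / 2 ^ r % 2 = 0 then 1 else 0 := by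
  rw [ag, Finset.sum_range_succ, Nat.div_eq_of_lt hw, ag]
  simp [eq_comm]

theorem ag_succ_high {w r : ℕ} (a : ℕ) (hw : w < 2 ^ r) :
    ag (r + 1) (2 ^ r + w) a = ag r w a + if a / 2 ^ r % 2 = 1 then 1 else 0 := by
  rw [ag, Finset.sum_range_succ, Nat.add_div_left _ (by positivity), Nat.div_eq_of_lt hw, ag]
  congr 1
  · refine Finset.sum_congr rfl fun j hj => ?_
    rw [bit_low (Finset.mem_range.1 hj)]
  · simp [eq_comm]

theorem mgf (u : ℝ) (r a : ℕ) :
    ∑ w ∈ Finset.range (2 ^ r), Real.exp (u * (2 * (ag r w a : ℝ) - r)) =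
      (Real.exp u + Real.exp (-u)) ^ r := by
  induction r with
  | zero => simp [ag]
  | succ r ih =>
    rw [pow_succ 2, mul_two, Finset.sum_range_add, pow_succ, ← ih, Finset.sum_mul,
      ← Finset.sum_add_distrib]
    refine Finset.sum_congr rfl fun w hw => ?_
    have hw' := Finset.mem_range.1 hw
    rw [ag_succ_low a hw', ag_succ_high a hw', mul_add, ← Real.exp_add, ← Real.exp_add]
    rcases Nat.mod_two_eq_zero_or_one (a / 2 ^ r) with h | h
    · simp only [h]
      push_cast
      norm_num
      congr 2 <;> ring
    · simp only [h]
      push_cast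
      norm_num
      rw [add_comm]
      congr 2 <;> ring

/-- Words having large agreement with `a`. -/
def badBall (K r a : ℕ) : Finset ℕ :=
  (Finset.range (2 ^ r)).filter fun w => (K ^ 2 + 2) * r < 2 * K ^ 2 * ag r w a

theorem card_badBall {K r : ℕ} (hK : 0 < K) (a : ℕ) :
    ((badBall K r a).card : ℝ) * Real.exp (2 * r / K ^ 4) ≤ 2 ^ r := by
  have hK' : (0 : ℝ) < K := by exact_mod_cast hK
  have hK2 : (0 : ℝ) < (K : ℝ) ^ 2 := by positivity
  set u : ℝ := 2 / K ^ 2 with hu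
  have h1 : ((badBall K r a).card : ℝ) * Real.exp (u * (2 * r / K ^ 2)) ≤
      (Real.exp u + Real.exp (-u)) ^ r := by
    rw [← mgf u r a, ← nsmul_eq_mul, ← Finset.sum_const]
    refine (Finset.sum_le_sum fun w hw => ?_).trans
      (Finset.sum_le_sum_of_subset_of_nonneg (Finset.filter_subset _ _)
        fun _ _ _ => (Real.exp_pos _).le)
    apply Real.exp_le_exp.2
    have hw2 := (Finset.mem_filter.1 hw).2
    have hw3 : ((K ^ 2 + 2) * r : ℝ) < 2 * K ^ 2 * ag r w a := by exact_mod_cast hw2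
    apply mul_le_mul_of_nonneg_left _ (by positivity)
    rw [div_le_iff₀ hK2]
    nlinarith
  have h2 : Real.exp u + Real.exp (-u) ≤ 2 * Real.exp (u ^ 2 / 2) := by
    have := Real.cosh_le_exp_half_sq u
    rw [Real.cosh_eq] at this
    linarith
  have h3 : (Real.exp u + Real.exp (-u)) ^ r ≤ 2 ^ r * Real.exp (2 * r / K ^ 4) := by
    refine (pow_le_pow_left₀ (by positivity) h2 r).trans (le_of_eq ?_)
    rw [mul_pow, ← Real.exp_nat_mul]
    congr 2
    rw [hu]; field_simp
  have h4 : Real.exp (u * (2 * r / K ^ 2)) =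
      Real.exp (2 * r / K ^ 4) * Real.exp (2 * r / K ^ 4) := by
    rw [← Real.exp_add]; congr 1
    rw [hu]; field_simp; ring
  rw [h4, ← mul_assoc] at h1
  exact le_of_mul_le_mul_right (h1.trans h3) (Real.exp_pos _)

theorem greedy {K r : ℕ} (hK : 0 < K) (M : ℕ) (hM : (M : ℝ) ≤ Real.exp (2 * r / K ^ 4)) :
    ∃ e : ℕ → ℕ, ∀ m < M, ∀ m' < m, 2 * K ^ 2 * ag r (e m) (e m') ≤ (K ^ 2 + 2) * r := by
  induction M with
  | zero => exact ⟨fun _ => 0, by simp⟩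
  | succ M ih =>
    push_cast at hM
    obtain ⟨e, he⟩ := ih (by linarith)
    have hcard : ((Finset.range M).biUnion fun m => badBall K r (e m)).card < 2 ^ r := by
      have h1 : (((Finset.range M).biUnion fun m => badBall K r (e m)).card : ℝ) ≤
          ∑ m ∈ Finset.range M, ((badBall K r (e m)).card : ℝ) := by
        exact_mod_cast Finset.card_biUnion_le
      have h2 : (∑ m ∈ Finset.range M, ((badBall K r (e m)).card : ℝ)) *
          Real.exp (2 * r / K ^ 4) ≤ M * 2 ^ r := by
        rw [Finset.sum_mul]
        refine (Finset.sum_le_sum fun m _ => card_badBall hK (e m)).trans ?_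
        simp
      have h3 : (((Finset.range M).biUnion fun m => badBall K r (e m)).card : ℝ) *
          Real.exp (2 * r / K ^ 4) < 2 ^ r * Real.exp (2 * r / K ^ 4) := by
        calc _ ≤ _ := mul_le_mul_of_nonneg_right h1 (Real.exp_pos _).le
          _ ≤ _ := h2
          _ = 2 ^ r * M := by ring
          _ < _ := by
            apply mul_lt_mul_of_pos_left _ (by positivity)
            linarith
      have h4 := lt_of_mul_lt_mul_right h3 (Real.exp_pos _).le
      exact_mod_cast h4
    obtain ⟨w, hw, hwn⟩ : ∃ w ∈ Finset.range (2 ^ r),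
        w ∉ (Finset.range M).biUnion fun m => badBall K r (e m) :=
      Finset.exists_mem_notMem_of_card_lt_card (by simpa using hcard)
    refine ⟨fun m => if m = M then w else e m, fun m hm m' hm' => ?_⟩
    have hne : m' ≠ M := by omega
    by_cases h : m = M
    · simp only [h, hne, if_true, if_false]
      by_contra hbad
      refine hwn (Finset.mem_biUnion.2 ⟨m', Finset.mem_range.2 (by omega), ?_⟩)
      exact Finset.mem_filter.2 ⟨hw, not_le.1 hbad⟩
    · simp only [h, hne, if_false]
      exact he m (by omega) m' hm'

/-- Number of messages at level `n`. -/
def numMsg (K n : ℕ) : ℕ := 2 ^ (K ^ 2 * 2 ^ n)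

/-- Word length at level `n`. -/
def wlen (K n : ℕ) : ℕ := K ^ 6 * 2 ^ n

theorem computable_ag {α : Type*} [Primcodable α] {r a b : α → ℕ} (hr : Computable r)
    (ha : Computable a) (hb : Computable b) : Computable fun x => ag (r x) (a x) (b x) := by
  refine computable_sum
    (F := fun x j => if a x / 2 ^ j % 2 = b x / 2 ^ j % 2 then 1 else 0) ?_ hr
  have h2 : Computable fun _ : α × ℕ => 2 := Computable.const 2
  exact computable_ite_eq
    (cmod (cdiv (ha.comp Computable.fst) (cpow2 Computable.snd)) h2)
    (cmod (cdiv (hb.comp Computable.fst) (cpow2 Computable.snd)) h2)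
    (Computable.const 1) (Computable.const 0)

theorem computable_numMsg (K : ℕ) : Computable (numMsg K) :=
  cpow2 (cmul (Computable.const (K ^ 2)) computable_pow2)

theorem computable_wlen (K : ℕ) : Computable (wlen K) :=
  cmul (Computable.const (K ^ 6)) computable_pow2

theorem numMsg_le {K : ℕ} (hK : 0 < K) (n : ℕ) :
    (numMsg K n : ℝ) ≤ Real.exp (2 * wlen K n / K ^ 4) := by
  have hK' : (0 : ℝ) < K := by exact_mod_cast hK
  have e1 : (2 * wlen K n / K ^ 4 : ℝ) = ((K ^ 2 * 2 ^ n : ℕ) : ℝ) * 2 := by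
    rw [wlen]; push_cast; field_simp
  rw [e1, Real.exp_nat_mul, numMsg]
  push_cast
  refine pow_le_pow_left₀ (by norm_num) ?_ _
  have := Real.add_one_le_exp (2 : ℝ)
  linarith

/-- Number of violated code constraints. -/
def viol (K n c : ℕ) : ℕ := ∑ m ∈ Finset.range (numMsg K n), ∑ m' ∈ Finset.range m,
  if (K ^ 2 + 2) * wlen K n < 2 * K ^ 2 * ag (wlen K n)
    ((Denumerable.ofNat (List ℕ) c).getD m 0) ((Denumerable.ofNat (List ℕ) c).getD m' 0)
  then 1 else 0

theorem computable_word : Computable₂ fun c m : ℕ => (Denumerable.ofNat (List ℕ) c).getD m 0 :=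
  (Primrec.list_getD 0).to_comp.comp ((Computable.ofNat (List ℕ)).comp Computable.fst) Computable.snd

theorem computable_viol (K : ℕ) : Computable₂ (viol K) := by
  refine computable_sum (α := ℕ × ℕ) (N := fun p => numMsg K p.1)
    (F := fun p m => ∑ m' ∈ Finset.range m,
      if (K ^ 2 + 2) * wlen K p.1 < 2 * K ^ 2 * ag (wlen K p.1)
        ((Denumerable.ofNat (List ℕ) p.2).getD m 0) ((Denumerable.ofNat (List ℕ) p.2).getD m' 0)
      then 1 else 0) ?_ ((computable_numMsg K).comp Computable.fst)
  refine computable_sum (α := (ℕ × ℕ) × ℕ) (N := fun p => p.2)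
    (F := fun p m' =>
      if (K ^ 2 + 2) * wlen K p.1.1 < 2 * K ^ 2 * ag (wlen K p.1.1)
        ((Denumerable.ofNat (List ℕ) p.1.2).getD p.2 0) ((Denumerable.ofNat (List ℕ) p.1.2).getD m' 0)
      then 1 else 0) ?_ Computable.snd
  have hw : Computable fun p : ((ℕ × ℕ) × ℕ) × ℕ => wlen K p.1.1.1 :=
    (computable_wlen K).comp (Computable.fst.comp (Computable.fst.comp Computable.fst))
  have hc : Computable fun p : ((ℕ × ℕ) × ℕ) × ℕ => p.1.1.2 :=
    Computable.snd.comp (Computable.fst.comp Computable.fst)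
  have hm : Computable fun p : ((ℕ × ℕ) × ℕ) × ℕ => p.1.2 := Computable.snd.comp Computable.fst
  exact computable_ite_lt (cmul (Computable.const _) hw)
    (cmul (Computable.const _) (computable_ag hw (computable_word.comp hc hm)
      (computable_word.comp hc Computable.snd))) (Computable.const 1) (Computable.const 0)

theorem exists_code_family {K : ℕ} (hK : 0 < K) : ∃ E : ℕ → ℕ → ℕ, Computable₂ E ∧
    ∀ n, ∀ m < numMsg K n, ∀ m' < numMsg K n, m ≠ m' →
      2 * K ^ 2 * ag (wlen K n) (E n m) (E n m') ≤ (K ^ 2 + 2) * wlen K n := by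
  have hex : ∀ n, ∃ c, viol K n c = 0 := by
    intro n
    obtain ⟨e, he⟩ := greedy hK _ (numMsg_le hK n)
    refine ⟨Encodable.encode ((List.range (numMsg K n)).map e), ?_⟩
    rw [viol]
    refine Finset.sum_eq_zero fun m hm => Finset.sum_eq_zero fun m' hm' => ?_
    have h1 := Finset.mem_range.1 hm
    have h2 := Finset.mem_range.1 hm'
    rw [if_neg]
    have h3 : m' < numMsg K n := h2.trans h1
    have := he m h1 m' h2
    simp [List.getD, h1, h3]
    exact this
  refine ⟨fun n m => (Denumerable.ofNat (List ℕ) (Nat.find (hex n))).getD m 0, ?_, ?_⟩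
  · exact computable_word.comp ((computable_find (computable_viol K) hex).comp Computable.fst)
      Computable.snd
  · intro n
    have key : ∀ m < numMsg K n, ∀ m' < m, 2 * K ^ 2 * ag (wlen K n)
        ((Denumerable.ofNat (List ℕ) (Nat.find (hex n))).getD m 0)
        ((Denumerable.ofNat (List ℕ) (Nat.find (hex n))).getD m' 0) ≤ (K ^ 2 + 2) * wlen K n := by
      intro m hm m' hm'
      have h0 := Nat.find_spec (hex n)
      rw [viol, Finset.sum_eq_zero_iff] at h0
      have h1 := h0 m (Finset.mem_range.2 hm)
      rw [Finset.sum_eq_zero_iff] at h1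
      have h2 := h1 m' (Finset.mem_range.2 hm')
      by_contra h
      rw [if_pos (not_le.1 h)] at h2
      omega
    intro m hm m' hm' hne
    rcases lt_or_gt_of_ne hne with h | h
    · rw [ag_comm]; exact key m' hm' m h
    · exact key m hm m' h

/-! ### The reduction of `IOE(2^(2^n))` to `D(p)` -/

/-- The number with base `b` digits `g 0, ..., g (n-1)`. -/
def digSum (b : ℕ) (g : ℕ → ℕ) (n : ℕ) : ℕ := ∑ j ∈ Finset.range n, g j * b ^ j

theorem digSum_lt {b : ℕ} {g : ℕ → ℕ} (n : ℕ) (hg : ∀ j < n, g j < b) :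
    digSum b g n < b ^ n := by
  induction n with
  | zero => simp [digSum]
  | succ k ih =>
    have e : digSum b g (k+1) = digSum b g k + g k * b ^ k := Finset.sum_range_succ _ _
    have h1 := hg k (by omega)
    have h2 := ih fun j hj => hg j (by omega)
    have : (g k + 1) * b ^ k ≤ b * b ^ k := Nat.mul_le_mul_right _ (by omega)
    rw [e, pow_succ']; nlinarith

theorem digSum_dig {b : ℕ} {g : ℕ → ℕ} {n : ℕ} (hg : ∀ j < n, g j < b) {j : ℕ} (hj : j < n) :
    digSum b g n / b ^ j % b = g j := by
  have hb : 0 < b := lt_of_le_of_lt (Nat.zero_le _) (hg j hj)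
  induction n with
  | zero => omega
  | succ k ih =>
    have e : digSum b g (k+1) = digSum b g k + g k * b ^ k := Finset.sum_range_succ _ _
    have hg' : ∀ j < k, g j < b := fun j hj => hg j (by omega)
    rcases Nat.lt_succ_iff_lt_or_eq.1 hj with h | rfl
    · rw [← ih hg' h, e]
      obtain ⟨d, rfl⟩ : ∃ d, k = j + 1 + d := ⟨k - (j+1), by omega⟩
      have : g (j+1+d) * b ^ (j+1+d) = b ^ j * (b * (b ^ d * g (j+1+d))) := by ring
      rw [this, Nat.add_mul_div_left _ _ (by positivity), Nat.add_mul_mod_self_left]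
    · rw [e, Nat.add_mul_div_right _ _ (by positivity), Nat.div_eq_of_lt (digSum_lt j hg'),
        Nat.zero_add, Nat.mod_eq_of_lt (hg j hj)]

theorem cnt_eq_sum (x y : ℕ → ℕ) (n : ℕ) :
    cnt x y n = ∑ j ∈ Finset.range n, if x j = y j then 1 else 0 := by
  rw [cnt, Finset.card_filter]

theorem cnt_mono (x y : ℕ → ℕ) {m n : ℕ} (h : m ≤ n) : cnt x y m ≤ cnt x y n :=
  Finset.card_le_card (Finset.filter_subset_filter _ (Finset.range_subset_range.2 h))

theorem wlen_pos {K : ℕ} (hK : 0 < K) (n : ℕ) : 0 < wlen K n := by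
  unfold wlen; positivity

theorem wlen_succ (K n : ℕ) : wlen K (n + 1) = 2 * wlen K n := by
  unfold wlen; ring

/-- The level of a position. -/
def lev (K j : ℕ) : ℕ := Nat.log 2 (j / K ^ 7)

theorem lev_eq {K n t o : ℕ} (hK : 0 < K) (ht : t < K) (ho : o < wlen K n) :
    lev K (wlen K n * (K + t) + o) = n := by
  have hr := wlen_pos hK n
  have h1 : K ^ 7 * 2 ^ n ≤ wlen K n * (K + t) + o := by
    have : K ^ 7 * 2 ^ n = wlen K n * K := by unfold wlen; ring
    rw [this]; nlinarith
  have h2 : wlen K n * (K + t) + o < K ^ 7 * 2 ^ (n + 1) := by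
    have : K ^ 7 * 2 ^ (n + 1) = wlen K n * (2 * K) := by unfold wlen; ring
    rw [this]
    have : wlen K n * (K + t + 1) ≤ wlen K n * (2 * K) := Nat.mul_le_mul_left _ (by omega)
    nlinarith
  unfold lev
  apply Nat.log_eq_of_pow_le_of_lt_pow
  · rw [Nat.le_div_iff_mul_le (by positivity), mul_comm]; exact h1
  · rw [Nat.div_lt_iff_lt_mul (by positivity), mul_comm (2 ^ (n + 1))]; exact h2

theorem div_wlen {K n t o : ℕ} (ho : o < wlen K n) :
    (wlen K n * (K + t) + o) / wlen K n - K = t := by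
  rw [Nat.mul_add_div (by omega), Nat.div_eq_of_lt ho]; omega

theorem mod_wlen {K n t o : ℕ} (ho : o < wlen K n) :
    (wlen K n * (K + t) + o) % wlen K n = o := by
  rw [Nat.mul_add_mod, Nat.mod_eq_of_lt ho]

theorem exists_block {K n0 N : ℕ} (hK : 0 < K) (hN : wlen K n0 * K ≤ N) :
    ∃ n ≥ n0, ∃ t < K, wlen K n * (K + t) ≤ N ∧ N < wlen K n * (K + t) + wlen K n := by
  have hr := fun n => wlen_pos hK n
  have e : ∀ n, wlen K n * K = 2 ^ n * K ^ 7 := fun n => by unfold wlen; ring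
  have h0 : 2 ^ n0 ≤ N / K ^ 7 := by
    rw [Nat.le_div_iff_mul_le (by positivity), ← e]; exact hN
  have hne : N / K ^ 7 ≠ 0 := by
    have : 0 < 2 ^ n0 := by positivity
    omega
  set n := Nat.log 2 (N / K ^ 7) with hn
  have h1 : wlen K n * K ≤ N := by
    rw [e, ← Nat.le_div_iff_mul_le (by positivity)]
    exact Nat.pow_log_le_self 2 hne
  have h2 : N < wlen K n * (K + K) := by
    have : N / K ^ 7 < 2 ^ (n + 1) := Nat.lt_pow_succ_log_self (by norm_num) _
    rw [Nat.div_lt_iff_lt_mul (by positivity), ← e, wlen_succ] at this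
    nlinarith
  refine ⟨n, Nat.le_log_of_pow_le (by norm_num) h0, N / wlen K n - K, ?_, ?_, ?_⟩
  · have : N / wlen K n < K + K := by
      rw [Nat.div_lt_iff_lt_mul (hr n), mul_comm]; exact h2
    omega
  · have : K ≤ N / wlen K n := by
      rw [Nat.le_div_iff_mul_le (hr n), mul_comm]; exact h1
    rw [Nat.add_sub_of_le this]
    exact Nat.mul_div_le _ _
  · have : K ≤ N / wlen K n := by
      rw [Nat.le_div_iff_mul_le (hr n), mul_comm]; exact h1
    rw [Nat.add_sub_of_le this]
    exact Nat.lt_mul_div_succ N (hr n)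

theorem density_lemma {K n0 : ℕ} (hK : 5 ≤ K) {x y : ℕ → ℕ}
    (h : ∀ n ≥ n0, ∀ t < K, (1 / 2 - 1 / K : ℝ) * wlen K n ≤
      (cnt x y (wlen K n * (K + t) + wlen K n) : ℝ) - cnt x y (wlen K n * (K + t))) :
    (1 / 2 - 2 / K : ℝ) ≤ lowerDensity (agree x y) := by
  have hK5 : (5 : ℝ) ≤ K := by exact_mod_cast hK
  have hK0 : (0 : ℝ) < K := by linarith
  set β : ℝ := 1 / 2 - 1 / K with hβ
  have hinv : (1 / K : ℝ) ≤ 1 / 5 := one_div_le_one_div_of_le (by norm_num) hK5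
  have hinv0 : (0 : ℝ) < 1 / K := by positivity
  have hβ0 : 0 ≤ β := by rw [hβ]; linarith
  set s0 : ℝ := wlen K n0 * K with hs0
  have hs0p : 0 ≤ s0 := by positivity
  have step : ∀ n ≥ n0, β * (wlen K n * K - s0) ≤ cnt x y (wlen K n * K) →
      ∀ t ≤ K, β * (wlen K n * (K + t) - s0) ≤ cnt x y (wlen K n * (K + t)) := by
    intro n hn hbase t
    induction t with
    | zero => intro _; simpa using hbase
    | succ t ih =>
      intro ht
      have h1 := ih (by omega)
      have h2 := h n hn t (by omega)
      have e : wlen K n * (K + (t + 1)) = wlen K n * (K + t) + wlen K n := by ring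
      rw [e]
      push_cast at h1 ⊢
      nlinarith
  have base : ∀ n ≥ n0, β * (wlen K n * K - s0) ≤ cnt x y (wlen K n * K) := by
    intro n hn
    induction n, hn using Nat.le_induction with
    | base => rw [← hs0]; simp
    | succ n hn ih =>
      have := step n hn ih K le_rfl
      have e : wlen K (n + 1) * K = wlen K n * (K + K) := by rw [wlen_succ]; ring
      have e' : (wlen K (n + 1) : ℝ) * K = wlen K n * (K + K) := by exact_mod_cast e
      rw [e, e']; exact this
  apply le_lowerDensity
  filter_upwards [eventually_ge_atTop (K * (wlen K n0 * K)), eventually_gt_atTop 0] with N hN hN0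
  have hN1 : wlen K n0 * K ≤ N := le_trans (Nat.le_mul_of_pos_left _ (by omega)) hN
  obtain ⟨n, hn, t, ht, hl, hu⟩ := exists_block (by omega) hN1
  have hc := step n hn (base n hn) t ht.le
  have hm : (cnt x y (wlen K n * (K + t)) : ℝ) ≤ cnt x y N := by
    exact_mod_cast cnt_mono x y hl
  have hNr : (0 : ℝ) < N := by exact_mod_cast hN0
  have hu' : (N : ℝ) < wlen K n * (K + t) + wlen K n := by exact_mod_cast hu
  have hl' : (wlen K n : ℝ) * K ≤ N := by
    have : wlen K n * K ≤ N := le_trans (Nat.mul_le_mul_left _ (by omega)) hl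
    exact_mod_cast this
  have hw : (wlen K n : ℝ) ≤ 1 / K * N := by
    rw [one_div, ← div_eq_inv_mul, le_div_iff₀ hK0]; exact hl'
  have hs : s0 ≤ 1 / K * N := by
    rw [one_div, ← div_eq_inv_mul, le_div_iff₀ hK0, mul_comm, hs0]
    exact_mod_cast hN
  rw [le_div_iff₀ hNr]
  have h3 : β * (N - 1 / K * N - 1 / K * N) ≤ cnt x y N := by
    refine le_trans ?_ (hc.trans hm)
    apply mul_le_mul_of_nonneg_left _ hβ0
    linarith
  refine le_trans ?_ h3
  have e2 : (2 / K : ℝ) = 2 * (1 / K) := by ring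
  rw [hβ, e2]
  set v : ℝ := 1 / K
  have : (1 / 2 - 2 * v) * N ≤ ((1 / 2 - v) * (1 - 2 * v)) * N := by
    apply mul_le_mul_of_nonneg_right _ hNr.le
    nlinarith [sq_nonneg v]
  linarith

/-- Goodness (0/1-valued) of a word with respect to `Y`: the agreement is small. -/
def gd (K r w Y : ℕ) : Prop := 2 * K * ag r w Y + 2 * r < K * r

instance (K r w Y : ℕ) : Decidable (gd K r w Y) := by unfold gd; infer_instance

/-- The `i`-th good message. -/
def sel (K : ℕ) (E : ℕ → ℕ → ℕ) (i n Y : ℕ) : ℕ :=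
  ∑ m ∈ Finset.range (numMsg K n), if gd K (wlen K n) (E n m) Y then
    (if (∑ m' ∈ Finset.range m, if gd K (wlen K n) (E n m') Y then 1 else 0) = i then m else 0)
    else 0

theorem computable_ite_gd {α : Type*} [Primcodable α] {K : ℕ} {r w Y f g : α → ℕ}
    (hr : Computable r) (hw : Computable w) (hY : Computable Y) (hf : Computable f)
    (hg : Computable g) : Computable fun a => if gd K (r a) (w a) (Y a) then f a else g a :=
  computable_ite_lt (a := fun a => 2 * K * ag (r a) (w a) (Y a) + 2 * r a)
    (b := fun a => K * r a)
    (cadd (cmul (Computable.const _) (computable_ag hr hw hY)) (cmul (Computable.const _) hr))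
    (cmul (Computable.const _) hr) hf hg

theorem computable_sel (K : ℕ) {E : ℕ → ℕ → ℕ} (hE : Computable₂ E) (i : ℕ) :
    Computable₂ (sel K E i) := by
  refine computable_sum (α := ℕ × ℕ) (N := fun p => numMsg K p.1)
    (F := fun p m => if gd K (wlen K p.1) (E p.1 m) p.2 then
      (if (∑ m' ∈ Finset.range m, if gd K (wlen K p.1) (E p.1 m') p.2 then 1 else 0) = i
        then m else 0) else 0) ?_ ((computable_numMsg K).comp Computable.fst)
  have p1 : Computable fun p : (ℕ × ℕ) × ℕ => p.1.1 := Computable.fst.comp Computable.fst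
  have p2 : Computable fun p : (ℕ × ℕ) × ℕ => p.1.2 := Computable.snd.comp Computable.fst
  have hs : Computable fun p : (ℕ × ℕ) × ℕ =>
      ∑ m' ∈ Finset.range p.2, if gd K (wlen K p.1.1) (E p.1.1 m') p.1.2 then 1 else 0 := by
    refine computable_sum (α := (ℕ × ℕ) × ℕ) (N := fun p => p.2)
      (F := fun p m' => if gd K (wlen K p.1.1) (E p.1.1 m') p.1.2 then 1 else 0) ?_ Computable.snd
    exact computable_ite_gd ((computable_wlen K).comp (p1.comp Computable.fst))
      (hE.comp (p1.comp Computable.fst) Computable.snd) (p2.comp Computable.fst)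
      (Computable.const 1) (Computable.const 0)
  exact computable_ite_gd ((computable_wlen K).comp p1) (hE.comp p1 Computable.snd) p2
    (computable_ite_eq hs (Computable.const i) Computable.snd (Computable.const 0))
    (Computable.const 0)

theorem exists_sel {K : ℕ} (hK : 0 < K) {E : ℕ → ℕ → ℕ} {n : ℕ}
    (hE : ∀ m < numMsg K n, ∀ m' < numMsg K n, m ≠ m' →
      2 * K ^ 2 * ag (wlen K n) (E n m) (E n m') ≤ (K ^ 2 + 2) * wlen K n) {Y m : ℕ}
    (hm : m < numMsg K n) (hg : gd K (wlen K n) (E n m) Y) :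
    ∃ i < K ^ 2, sel K E i n Y = m := by
  classical
  set p : ℕ → Prop := fun m => gd K (wlen K n) (E n m) Y with hp
  have hcount : ∀ m, (∑ m' ∈ Finset.range m, if gd K (wlen K n) (E n m') Y then 1 else 0)
      = Nat.count p m := by
    intro m
    rw [Nat.count_eq_card_filter_range, Finset.card_filter]
  refine ⟨Nat.count p m, ?_, ?_⟩
  · have hJ := johnson hK (wlen_pos hK n) ((Finset.range (numMsg K n)).filter p) (E n) Y
      (fun m' hm' => (Finset.mem_filter.1 hm').2)
      (fun a ha b hb => hE a (Finset.mem_range.1 (Finset.mem_filter.1 ha).1) b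
        (Finset.mem_range.1 (Finset.mem_filter.1 hb).1))
    refine lt_of_lt_of_le ?_ hJ
    rw [← Nat.count_eq_card_filter_range]
    exact Nat.count_strict_mono hg hm
  · rw [sel]
    simp only [hcount]
    rw [Finset.sum_eq_single m]
    · simp [hg]
    · intro b _ hb
      by_cases hpb : gd K (wlen K n) (E n b) Y
      · rw [if_pos hpb, if_neg]
        intro hc
        exact hb (Nat.count_injective (p := p) hpb hg hc)
      · rw [if_neg hpb]
    · intro h; exact absurd (Finset.mem_range.2 hm) h

theorem IOE_le_probD {p : ℝ} (hp1 : p < 1 / 2) :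
    MuchnikLE (IOE fun n => 2 ^ 2 ^ n) (probD p) := by
  intro y hy
  obtain ⟨hyb, hyd⟩ := hy
  obtain ⟨K0, hK0⟩ := exists_nat_gt (2 / (1 / 2 - p))
  set K := K0 + 5 with hKdef
  have hK5 : 5 ≤ K := by omega
  have hKpos : 0 < K := by omega
  have hKp : p < 1 / 2 - 2 / (K : ℝ) := by
    have h1 : (0 : ℝ) < 1 / 2 - p := by linarith
    have h2 : 2 / (1 / 2 - p) < (K : ℝ) := hK0.trans (by rw [hKdef]; push_cast; linarith)
    have h3 : (2 : ℝ) / K < 1 / 2 - p := by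
      rw [div_lt_iff₀ h1] at h2
      rw [div_lt_iff₀ (by positivity)]
      linarith
    linarith
  obtain ⟨E, hEc, hE⟩ := exists_code_family hKpos
  by_contra hcon
  push Not at hcon
  -- the word of `y` on block `(n, t)`
  set Yw : ℕ → ℕ → ℕ := fun t n =>
    bitSum y (wlen K n * (K + t) + wlen K n) / 2 ^ (wlen K n * (K + t)) with hYw
  set f : ℕ → ℕ → ℕ := fun u n =>
    sel K E (u % K ^ 2) n (Yw (u / K ^ 2) n) / (2 ^ 2 ^ n) ^ (u % K ^ 2) % 2 ^ 2 ^ n with hf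
  have cw := computable_wlen K
  have hT : ∀ u, TuringLE (f u) y := by
    intro u
    refine turingLE_comp (G := bitSum y)
      (q := fun n => wlen K n * (K + u / K ^ 2) + wlen K n)
      (H := fun n v => sel K E (u % K ^ 2) n (v / 2 ^ (wlen K n * (K + u / K ^ 2))) /
        (2 ^ 2 ^ n) ^ (u % K ^ 2) % 2 ^ 2 ^ n)
      (turingLE_bitSum y) (cadd (cmul cw (Computable.const _)) cw) ?_
    have cp : Computable fun a : ℕ × ℕ => 2 ^ 2 ^ a.1 := cpow2 (cpow2 Computable.fst)
    have cpp : Computable fun a : ℕ × ℕ => (2 ^ 2 ^ a.1) ^ (u % K ^ 2) := by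
      simp only [← pow_mul]
      exact cpow2 (cmul (cpow2 Computable.fst) (Computable.const _))
    exact cmod (cdiv ((computable_sel K hEc _).comp Computable.fst
      (cdiv Computable.snd (cpow2 (cmul (cw.comp Computable.fst) (Computable.const _))))) cpp) cp
  have hn : ∀ u, ∃ x : ℕ → ℕ, Computable x ∧ (∀ n, x n < 2 ^ 2 ^ n) ∧
      ∀ᶠ n in atTop, f u n ≠ x n := by
    intro u
    have : f u ∉ IOE fun n => 2 ^ 2 ^ n := fun h => hcon _ h (hT u)
    simp only [IOE, Set.mem_ofPred_eq, not_forall, Filter.not_frequently] at this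
    obtain ⟨x, h1, h2, h3⟩ := this
    exact ⟨x, h1, h2, h3⟩
  choose x' hxc hxlt hxne using hn
  obtain ⟨X, hX, hXx⟩ := computable_family (K * K ^ 2) x' fun i _ => hxc i
  have hev : ∀ᶠ n in atTop, ∀ u ∈ Finset.range (K * K ^ 2), f u n ≠ x' u n :=
    (Filter.eventually_all_finset _).2 fun u _ => hxne u
  obtain ⟨n0, hn0⟩ := Filter.eventually_atTop.1 hev
  set msg : ℕ → ℕ → ℕ := fun n t => digSum (2 ^ 2 ^ n) (fun i => X (t * K ^ 2 + i) n) (K ^ 2)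
    with hmsg
  set x : ℕ → ℕ := fun j => E (lev K j) (msg (lev K j) (j / wlen K (lev K j) - K)) /
    2 ^ (j % wlen K (lev K j)) % 2 with hx
  have hxb : IsBitSeq x := fun j => Nat.mod_lt _ (by norm_num)
  have hmsgc : Computable₂ msg := by
    refine computable_sum (α := ℕ × ℕ) (N := fun _ => K ^ 2)
      (F := fun q i => X (q.2 * K ^ 2 + i) q.1 * (2 ^ 2 ^ q.1) ^ i) ?_ (Computable.const _)
    have q1 : Computable fun q : (ℕ × ℕ) × ℕ => q.1.1 := Computable.fst.comp Computable.fst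
    have q2 : Computable fun q : (ℕ × ℕ) × ℕ => q.1.2 := Computable.snd.comp Computable.fst
    have cpp : Computable fun q : (ℕ × ℕ) × ℕ => (2 ^ 2 ^ q.1.1) ^ q.2 := by
      simp only [← pow_mul]
      exact cpow2 (cmul (cpow2 q1) Computable.snd)
    exact cmul (hX.comp (cadd (cmul q2 (Computable.const _)) Computable.snd) q1) cpp
  have hlev : Computable (lev K) := clog2.comp (cdiv Computable.id (Computable.const _))
  have hwl : Computable fun j => wlen K (lev K j) := cw.comp hlev
  have hxcomp : Computable x :=
    cmod (cdiv (hEc.comp hlev (hmsgc.comp hlev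
      (csub (cdiv Computable.id hwl) (Computable.const _))))
      (cpow2 (cmod Computable.id hwl))) (Computable.const 2)
  have hXlt : ∀ _ : ℕ, ∀ t < K, ∀ i < K ^ 2, t * K ^ 2 + i < K * K ^ 2 := by
    intro n t ht i hi
    have : (t + 1) * K ^ 2 ≤ K * K ^ 2 := Nat.mul_le_mul_right _ ht
    nlinarith
  have hdig : ∀ n, ∀ t < K, ∀ i < K ^ 2, X (t * K ^ 2 + i) n < 2 ^ 2 ^ n := by
    intro n t ht i hi
    rw [hXx _ (hXlt n t ht i hi)]
    exact hxlt _ _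
  have hmsglt : ∀ n, ∀ t < K, msg n t < numMsg K n := by
    intro n t ht
    have := digSum_lt (K ^ 2) (hdig n t ht)
    rw [numMsg, mul_comm, pow_mul]; exact this
  -- blocks are not good
  have hnot : ∀ n ≥ n0, ∀ t < K, ¬ gd K (wlen K n) (E n (msg n t)) (Yw t n) := by
    intro n hn t ht hg
    obtain ⟨i, hi, hsel⟩ := exists_sel hKpos (hE n) (hmsglt n t ht) hg
    have hu := hXlt n t ht i hi
    have hne := hn0 n hn (t * K ^ 2 + i) (Finset.mem_range.2 hu)
    apply hne
    have e1 : (t * K ^ 2 + i) % K ^ 2 = i := by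
      rw [Nat.mul_comm, Nat.mul_add_mod, Nat.mod_eq_of_lt hi]
    have e2 : (t * K ^ 2 + i) / K ^ 2 = t := by
      rw [Nat.mul_comm, Nat.mul_add_div (by positivity), Nat.div_eq_of_lt hi, Nat.add_zero]
    simp only [hf, e1, e2]
    rw [hsel, hmsg]
    rw [digSum_dig (hdig n t ht) hi, hXx _ hu]
  have hblock : ∀ n, ∀ t < K, cnt x y (wlen K n * (K + t) + wlen K n) =
      cnt x y (wlen K n * (K + t)) + ag (wlen K n) (E n (msg n t)) (Yw t n) := by
    intro n t ht
    rw [cnt_eq_sum, cnt_eq_sum, Finset.sum_range_add, ag]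
    congr 1
    refine Finset.sum_congr rfl fun o ho => ?_
    have ho' := Finset.mem_range.1 ho
    have ex : x (wlen K n * (K + t) + o) = E n (msg n t) / 2 ^ o % 2 := by
      simp only [hx]
      rw [lev_eq hKpos ht ho', div_wlen ho', mod_wlen ho']
    have ey : Yw t n / 2 ^ o % 2 = y (wlen K n * (K + t) + o) := by
      simp only [hYw]
      rw [Nat.div_div_eq_div_mul, ← pow_add]
      exact bitSum_bit hyb (by omega)
    rw [ex, ey]
  have hdens := density_lemma (n0 := n0) hK5 (x := x) (y := y) (by
    intro n hn t ht
    have h1 := hnot n hn t ht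
    rw [gd, not_lt] at h1
    rw [hblock n t ht]
    have h2 : (K * wlen K n : ℝ) ≤ 2 * K * ag (wlen K n) (E n (msg n t)) (Yw t n) +
      2 * wlen K n := by exact_mod_cast h1
    have hKr : (0 : ℝ) < K := by exact_mod_cast hKpos
    push_cast
    have e : (1 / 2 - 1 / K : ℝ) * wlen K n = (K * wlen K n - 2 * wlen K n) / (2 * K) := by
      field_simp
    rw [e, add_sub_cancel_left, div_le_iff₀ (by positivity)]
    linarith)
  have := hyd x hxb hxcomp
  linarith

/-- For every real `p` with `0 < p < 1/2`, the mass problem `D(p)` is Muchnik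
equivalent to `IOE(n ↦ 2^(2^n))`. -/
theorem stmt0 (p : ℝ) (hp0 : 0 < p) (hp1 : p < 1 / 2) :
    MuchnikLE (probD p) (IOE fun n => 2 ^ 2 ^ n) ∧
      MuchnikLE (IOE fun n => 2 ^ 2 ^ n) (probD p) := by
  exact ⟨probD_le_IOE hp0, IOE_le_probD hp1⟩

end Paper
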